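/- There exists a universal constant Θ' ∈ (0,∞) with the following property. Let n ≥ 3, R > 0, and let X ∈ C²(B,ℝⁿ) ∩ C⁰(B̄,ℝⁿ) be a conformally parametrized minimal surface graph over B_R (X harmonic in B; |X_u|² = |X_v|² = W, X_u·X_v = 0, W > 0 in B; the first two components F*(u,v) = (x¹(u,v), x²(u,v)) map B̄ one-to-one onto B̄_R with positive Jacobian, F*(0,0) = (0,0), and F*: ∂B → ∂B_R a topological mapping). Then for every differentiable unit normal field N along X, the Gaussian curvature in direction N satisfies |K_N(0,0)| ≤ Θ'·‖X‖²_{C⁰(B)} / R⁴. -/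

import Mathlib

open scoped RealInnerProductSpace

/-- First partial derivative (w.r.t. the first variable `u`). -/
noncomputable def pd1 {E : Type*} [NormedAddCommGroup E] [NormedSpace ℝ E]
    (f : ℝ × ℝ → E) (p : ℝ × ℝ) : E := fderiv ℝ f p (1, 0)

/-- Second partial derivative (w.r.t. the second variable `v`). -/
noncomputable def pd2 {E : Type*} [NormedAddCommGroup E] [NormedSpace ℝ E]
    (f : ℝ × ℝ → E) (p : ℝ × ℝ) : E := fderiv ℝ f p (0, 1)

/-- The open unit disc `B = {(u,v) : u² + v² < 1}`. -/
def unitB : Set (ℝ × ℝ) := {p | p.1 ^ 2 + p.2 ^ 2 < 1}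

/-- The open disc `B_R = {(x,y) : x² + y² < R²}`. -/
def diskR (R : ℝ) : Set (ℝ × ℝ) := {p | p.1 ^ 2 + p.2 ^ 2 < R ^ 2}

/-- The circle `∂B_R = {(x,y) : x² + y² = R²}`. -/
def circleR (R : ℝ) : Set (ℝ × ℝ) := {p | p.1 ^ 2 + p.2 ^ 2 = R ^ 2}

open Complex Metric MeasureTheory InnerProductSpace Filter
open scoped Real Topology

theorem isOpen_unitB : IsOpen unitB :=
  isOpen_lt (by fun_prop) continuous_const

theorem equivRealProdCLM_mem_unitB {z : ℂ} (hz : z ∈ ball (0 : ℂ) 1) :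
    equivRealProdCLM z ∈ unitB := by
  have h : ‖z‖ < 1 := by simpa using hz
  have h2 : ‖z‖ ^ 2 < 1 := by nlinarith [norm_nonneg z]
  rw [Complex.sq_norm, normSq_apply] at h2
  simp only [unitB, Set.mem_ofPred_eq, equivRealProdCLM_apply]
  nlinarith

theorem equivRealProdCLM_symm_mem_ball {p : ℝ × ℝ} (hp : p ∈ unitB) :
    equivRealProdCLM.symm p ∈ ball (0 : ℂ) 1 := by
  have h : p.1 ^ 2 + p.2 ^ 2 < 1 := hp
  rw [mem_ball_zero_iff, ← sq_lt_one_iff₀ (norm_nonneg _), Complex.sq_norm, normSq_apply]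
  simpa [equivRealProdCLM_symm_apply, sq] using h

theorem integral_holomorphic_mul_exp_neg {F : ℂ → ℂ} (hF : DifferentiableOn ℂ F (ball 0 1))
    {r : ℝ} (h0 : 0 < r) (h1 : r < 1) (n : ℕ) :
    ∫ t in (0 : ℝ)..2 * π, F (circleMap 0 r t) * cexp (-(n * t * I)) =
      2 * π * r ^ n / n.factorial * iteratedDeriv n F 0 := by
  have h := (hF.mono (closedBall_subset_ball h1)).circleIntegral_one_div_sub_center_pow_smul h0 n
  have hr : (r : ℂ) ≠ 0 := by exact_mod_cast h0.ne'
  have key : ∮ z in C(0, r), (1 / (z - 0) ^ (n + 1)) • F z =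
      (I / r ^ n) * ∫ t in (0 : ℝ)..2 * π, F (circleMap 0 r t) * cexp (-(n * t * I)) := by
    rw [circleIntegral, ← intervalIntegral.integral_const_mul]
    congr 1
    ext t
    have he := Complex.exp_ne_zero (t * I)
    have hen : cexp (-(n * t * I)) = (cexp (t * I) ^ n)⁻¹ := by
      rw [Complex.exp_neg, ← Complex.exp_nat_mul, mul_assoc]
    simp only [deriv_circleMap, circleMap, zero_add, sub_zero, smul_eq_mul, hen]
    field_simp
    ring
  rw [key] at h
  have hI := I_ne_zero
  have hf : (n.factorial : ℂ) ≠ 0 := by exact_mod_cast n.factorial_ne_zero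
  rw [smul_eq_mul] at h
  field_simp at h ⊢
  linear_combination h

theorem integral_holomorphic_mul_exp {F : ℂ → ℂ} (hF : DifferentiableOn ℂ F (ball 0 1))
    {r : ℝ} (h0 : 0 < r) (h1 : r < 1) (n : ℕ) :
    ∫ t in (0 : ℝ)..2 * π, F (circleMap 0 r t) * cexp ((n + 1) * t * I) = 0 := by
  have hd : DifferentiableOn ℂ (fun z => F z * z ^ n) (closedBall 0 r) :=
    (hF.mono (closedBall_subset_ball h1)).mul (by fun_prop)
  have h := (hd.mono closure_ball_subset_closedBall).diffContOnCl.circleIntegral_eq_zero h0.le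
  have hr : (r : ℂ) ≠ 0 := by exact_mod_cast h0.ne'
  have key : ∮ z in C(0, r), F z * z ^ n =
      (I * r ^ (n + 1)) *
        ∫ t in (0 : ℝ)..2 * π, F (circleMap 0 r t) * cexp ((n + 1) * t * I) := by
    rw [circleIntegral, ← intervalIntegral.integral_const_mul]
    congr 1
    ext t
    have hen : cexp ((n + 1) * t * I) = cexp (t * I) ^ (n + 1) := by
      rw [← Complex.exp_nat_mul, mul_assoc]; push_cast; rfl
    simp only [deriv_circleMap, circleMap, zero_add, smul_eq_mul, hen]
    ring
  rw [key] at h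
  simpa [hr] using h

theorem continuous_comp_circleMap {F : ℂ → ℂ} (hF : DifferentiableOn ℂ F (ball 0 1))
    {r : ℝ} (h0 : 0 < r) (h1 : r < 1) : Continuous fun t => F (circleMap 0 r t) :=
  hF.continuousOn.comp_continuous (continuous_circleMap 0 r) fun t => by
    simp [abs_of_pos h0, h1]

theorem integral_re_mul_exp {F : ℂ → ℂ} (hF : DifferentiableOn ℂ F (ball 0 1))
    {r : ℝ} (h0 : 0 < r) (h1 : r < 1) (n : ℕ) :
    ∫ t in (0 : ℝ)..2 * π, ((F (circleMap 0 r t)).re : ℂ) * cexp (-((n + 1) * t * I)) =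
      π * r ^ (n + 1) / (n + 1).factorial * iteratedDeriv (n + 1) F 0 := by
  have hc := continuous_comp_circleMap hF h0 h1
  have hconj : ∫ t in (0 : ℝ)..2 * π,
      (starRingEnd ℂ) (F (circleMap 0 r t)) * cexp (-((n + 1) * t * I)) = 0 := by
    have := congrArg (starRingEnd ℂ) (integral_holomorphic_mul_exp hF h0 h1 n)
    rw [intervalIntegral.integral_of_le Real.two_pi_pos.le, ← integral_conj,
      ← intervalIntegral.integral_of_le Real.two_pi_pos.le, map_zero] at this
    refine Eq.trans ?_ this
    congr 1
    ext t
    rw [map_mul, ← Complex.exp_conj]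
    simp
  have h := integral_holomorphic_mul_exp_neg hF h0 h1 (n + 1)
  push_cast at h
  have hsum : ∀ t : ℝ, ((F (circleMap 0 r t)).re : ℂ) * cexp (-((n + 1) * t * I)) =
      (1 / 2) * (F (circleMap 0 r t) * cexp (-((n + 1) * t * I)) +
        (starRingEnd ℂ) (F (circleMap 0 r t)) * cexp (-((n + 1) * t * I))) := by
    intro t
    rw [Complex.re_eq_add_conj]
    ring
  simp_rw [hsum]
  rw [intervalIntegral.integral_const_mul, intervalIntegral.integral_add, hconj, h]
  · ring
  · exact Continuous.intervalIntegrable (hc.mul (by fun_prop)) _ _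
  · exact Continuous.intervalIntegrable
      ((Complex.continuous_conj.comp hc).mul (by fun_prop)) _ _

theorem integral_re_eq {F : ℂ → ℂ} (hF : DifferentiableOn ℂ F (ball 0 1))
    {r : ℝ} (h0 : 0 < r) (h1 : r < 1) :
    ∫ t in (0 : ℝ)..2 * π, (F (circleMap 0 r t)).re = 2 * π * (F 0).re := by
  have h := integral_holomorphic_mul_exp_neg hF h0 h1 0
  have hc := continuous_comp_circleMap hF h0 h1
  have := reCLM.intervalIntegral_comp_comm (hc.intervalIntegrable 0 (2 * π) (μ := volume))
  simp only [reCLM_apply] at this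
  rw [this]
  simp at h
  rw [h]
  simp

/-- A harmonic function on the unit disc is the real part of a holomorphic function. -/
theorem exists_holomorphic_re_eq {w : ℝ × ℝ → ℝ} (hw : ContDiffOn ℝ 2 w unitB)
    (hlap : ∀ p ∈ unitB, pd1 (pd1 w) p + pd2 (pd2 w) p = 0) :
    ∃ F : ℂ → ℂ, DifferentiableOn ℂ F (ball 0 1) ∧
      ∀ p ∈ unitB, w p = (F (equivRealProdCLM.symm p)).re := by
  have hsnd : ∀ z ∈ ball (0 : ℂ) 1, ∀ a b : ℂ,
      fderiv ℝ (fderiv ℝ (w ∘ equivRealProdCLM)) z a b =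
        fderiv ℝ (fun q => fderiv ℝ w q (equivRealProdCLM b)) (equivRealProdCLM z)
          (equivRealProdCLM a) := by
    intro z hz a b
    have hcd : ContDiffAt ℝ 2 (w ∘ equivRealProdCLM) z :=
      ((hw.contDiffAt (isOpen_unitB.mem_nhds (equivRealProdCLM_mem_unitB hz)))).comp z
        equivRealProdCLM.contDiff.contDiffAt
    have hdd : DifferentiableAt ℝ (fderiv ℝ (w ∘ equivRealProdCLM)) z :=
      (hcd.fderiv_right (m := 1) (by norm_num)).differentiableAt (by norm_num)
    have h1 : fderiv ℝ (fderiv ℝ (w ∘ equivRealProdCLM)) z a b =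
        fderiv ℝ (fun y => fderiv ℝ (w ∘ equivRealProdCLM) y b) z a := by
      rw [fderiv_clm_apply hdd (by fun_prop)]
      simp
    have h2 : (fun y => fderiv ℝ (w ∘ equivRealProdCLM) y b) =
        (fun q => fderiv ℝ w q (equivRealProdCLM b)) ∘ equivRealProdCLM := by
      ext y
      rw [ContinuousLinearEquiv.comp_right_fderiv]
      rfl
    rw [h1, h2, ContinuousLinearEquiv.comp_right_fderiv]
    rfl
  have hharm : HarmonicOnNhd (w ∘ equivRealProdCLM) (ball (0 : ℂ) 1) := by
    intro z hz
    refine ⟨(hw.contDiffAt (isOpen_unitB.mem_nhds (equivRealProdCLM_mem_unitB hz))).comp z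
        equivRealProdCLM.contDiff.contDiffAt, ?_⟩
    filter_upwards [isOpen_ball.mem_nhds hz] with y hy
    rw [laplacian_eq_iteratedFDeriv_complexPlane]
    simp only [iteratedFDeriv_two_apply, Matrix.cons_val_zero, Matrix.cons_val_one,
      Pi.zero_apply]
    rw [hsnd y hy, hsnd y hy]
    have := hlap _ (equivRealProdCLM_mem_unitB hy)
    simp only [equivRealProdCLM_apply, one_re, one_im, I_re, I_im] at this ⊢
    exact this
  obtain ⟨F, hF, hre⟩ := hharm.exists_analyticOnNhd_ball_re_eq
  refine ⟨F, hF.differentiableOn, fun p hp => ?_⟩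
  simpa using (hre (equivRealProdCLM_symm_mem_ball hp)).symm

theorem pd_eq_re_deriv {w : ℝ × ℝ → ℝ} {F : ℂ → ℂ} (hF : DifferentiableOn ℂ F (ball 0 1))
    (hw : ∀ p ∈ unitB, w p = (F (equivRealProdCLM.symm p)).re) {p : ℝ × ℝ} (hp : p ∈ unitB) :
    pd1 w p = (deriv F (equivRealProdCLM.symm p)).re ∧
      pd2 w p = (I * deriv F (equivRealProdCLM.symm p)).re := by
  have hd : HasDerivAt F (deriv F (equivRealProdCLM.symm p)) (equivRealProdCLM.symm p) :=
    (hF.differentiableAt (isOpen_ball.mem_nhds (equivRealProdCLM_symm_mem_ball hp))).hasDerivAt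
  have h1 := (reCLM.hasFDerivAt.comp p
    ((hd.hasFDerivAt.restrictScalars ℝ).comp p equivRealProdCLM.symm.hasFDerivAt))
  have h2 : w =ᶠ[𝓝 p] (reCLM ∘ (F ∘ equivRealProdCLM.symm)) := by
    filter_upwards [isOpen_unitB.mem_nhds hp] with q hq using hw q hq
  have h3 := (h1.congr_of_eventuallyEq h2).fderiv
  constructor
  · rw [pd1, h3]
    simp [equivRealProdCLM_symm_apply]
  · rw [pd2, h3]
    simp [equivRealProdCLM_symm_apply]

theorem zero_mem_unitB : ((0, 0) : ℝ × ℝ) ∈ unitB := by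
  simp [unitB]

theorem equivRealProdCLM_symm_zero : equivRealProdCLM.symm ((0, 0) : ℝ × ℝ) = 0 :=
  map_zero equivRealProdCLM.symm

theorem circleMap_eq_equivRealProdCLM_symm (r t : ℝ) :
    circleMap 0 r t = equivRealProdCLM.symm (r * Real.cos t, r * Real.sin t) := by
  rw [equivRealProdCLM_symm_apply, circleMap, Complex.exp_mul_I]
  push_cast
  ring

theorem mul_cos_sin_mem_unitB {r : ℝ} (h0 : 0 < r) (h1 : r < 1) (t : ℝ) :
    (r * Real.cos t, r * Real.sin t) ∈ unitB := by
  simp only [unitB, Set.mem_ofPred_eq]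
  have : (r * Real.cos t) ^ 2 + (r * Real.sin t) ^ 2 = r ^ 2 := by
    linear_combination r ^ 2 * Real.sin_sq_add_cos_sq t
  nlinarith

/-- Interior estimate for the second derivatives of a bounded harmonic function. -/
theorem harmonic_snd_deriv_bound {w : ℝ × ℝ → ℝ} (hw : ContDiffOn ℝ 2 w unitB)
    (hlap : ∀ p ∈ unitB, pd1 (pd1 w) p + pd2 (pd2 w) p = 0) {M : ℝ}
    (hM : ∀ p ∈ unitB, |w p| ≤ M) :
    pd1 (pd1 w) (0, 0) ^ 2 + pd1 (pd2 w) (0, 0) ^ 2 ≤ (16 * M) ^ 2 := by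
  obtain ⟨F, hF, hre⟩ := exists_holomorphic_re_eq hw hlap
  have hF' : DifferentiableOn ℂ (deriv F) (ball 0 1) := hF.deriv isOpen_ball
  have h11 := (pd_eq_re_deriv hF' (fun p hp => (pd_eq_re_deriv hF hre hp).1) zero_mem_unitB).1
  have h12 := (pd_eq_re_deriv (F := fun z => I * deriv F z) (hF'.const_mul I)
    (fun p hp => (pd_eq_re_deriv hF hre hp).2) zero_mem_unitB).1
  rw [equivRealProdCLM_symm_zero] at h11 h12
  have hd0 : DifferentiableAt ℂ (deriv F) 0 :=
    hF'.differentiableAt (isOpen_ball.mem_nhds (mem_ball_self one_pos))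
  rw [deriv_const_mul _ hd0] at h12
  have hint := integral_re_mul_exp hF (r := 1 / 2) (by norm_num) (by norm_num) 1
  have hbound : ‖∫ t in (0 : ℝ)..2 * π, ((F (circleMap 0 (1 / 2) t)).re : ℂ) *
      cexp (-(((1 : ℕ) + 1) * t * I))‖ ≤ M * |2 * π - 0| := by
    apply intervalIntegral.norm_integral_le_of_norm_le_const
    intro t _
    have he : ‖cexp (-(((1 : ℕ) + 1) * t * I))‖ = 1 := by
      rw [Complex.norm_exp]
      simp
    rw [norm_mul, he, mul_one, circleMap_eq_equivRealProdCLM_symm,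
      ← hre _ (mul_cos_sin_mem_unitB (by norm_num) (by norm_num) t), Complex.norm_real]
    exact hM _ (mul_cos_sin_mem_unitB (by norm_num) (by norm_num) t)
  rw [hint, iteratedDeriv_succ, iteratedDeriv_one, sub_zero, abs_of_pos Real.two_pi_pos,
    norm_mul] at hbound
  have hcoef : ‖(π * ((1 / 2 : ℝ) : ℂ) ^ (1 + 1) / ((1 + 1).factorial : ℂ))‖ = π / 8 := by
    simp only [norm_div, norm_mul, norm_pow, Complex.norm_real, Real.norm_eq_abs,
      abs_of_pos Real.pi_pos, Complex.norm_natCast]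
    norm_num [Nat.factorial]
    ring
  rw [hcoef] at hbound
  have hn : ‖deriv (deriv F) 0‖ ≤ 16 * M := by
    have := Real.pi_pos
    by_contra! hlt
    nlinarith
  have hsq : ‖deriv (deriv F) 0‖ ^ 2 ≤ (16 * M) ^ 2 :=
    pow_le_pow_left₀ (norm_nonneg _) hn 2
  rw [Complex.sq_norm, normSq_apply] at hsq
  rw [h11, h12]
  simp only [mul_re, I_re, I_im]
  nlinarith

theorem mem_closure_unitB {p : ℝ × ℝ} (hp : p.1 ^ 2 + p.2 ^ 2 ≤ 1) : p ∈ closure unitB := by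
  have ht : Tendsto (fun r : ℝ => r • p) (𝓝[<] 1) (𝓝 p) := by
    have : Tendsto (fun r : ℝ => r • p) (𝓝 1) (𝓝 ((1 : ℝ) • p)) :=
      (continuous_id.smul continuous_const).tendsto 1
    rw [one_smul] at this
    exact this.mono_left nhdsWithin_le_nhds
  refine mem_closure_of_tendsto ht ?_
  filter_upwards [Ioo_mem_nhdsLT (zero_lt_one (α := ℝ))] with r hr
  simp only [unitB, Set.mem_ofPred_eq, Prod.smul_fst, Prod.smul_snd, smul_eq_mul]
  have h2 : r ^ 2 < 1 := by nlinarith [hr.1, hr.2]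
  nlinarith [sq_nonneg p.1, sq_nonneg p.2, sq_nonneg r]

theorem isCompact_closure_unitB : IsCompact (closure unitB) := by
  refine (isCompact_Icc (a := ((-1, -1) : ℝ × ℝ)) (b := (1, 1))).closure_of_subset ?_
  rintro ⟨x, y⟩ h
  have h : x ^ 2 + y ^ 2 < 1 := h
  refine ⟨⟨?_, ?_⟩, ⟨?_, ?_⟩⟩ <;> simp only <;> nlinarith [sq_nonneg x, sq_nonneg y]

/-- An identity for integrals over circles of radius `r < 1` passes to the unit circle. -/
theorem integral_circle_limit {w : ℝ × ℝ → ℝ} (hw : ContinuousOn w (closure unitB))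
    {φ : ℝ → ℝ} (hφ : Continuous φ) {A : ℝ → ℝ} (hA : Continuous A)
    (h : ∀ r : ℝ, 0 < r → r < 1 →
      ∫ t in (0 : ℝ)..2 * π, w (r * Real.cos t, r * Real.sin t) * φ t = A r) :
    ∫ t in (0 : ℝ)..2 * π, w (Real.cos t, Real.sin t) * φ t = A 1 := by
  let κ : ℝ → ℝ := fun r => max 0 (min r 1)
  have hκc : Continuous κ := by fun_prop
  have hκ0 : ∀ r, 0 ≤ κ r := fun r => le_max_left _ _
  have hκ1 : ∀ r, κ r ≤ 1 := fun r => max_le zero_le_one (min_le_right _ _)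
  have hG : Continuous fun r : ℝ =>
      ∫ t in (0 : ℝ)..2 * π, w (κ r * Real.cos t, κ r * Real.sin t) * φ t := by
    apply intervalIntegral.continuous_parametric_intervalIntegral_of_continuous'
    refine Continuous.mul (hw.comp_continuous (by fun_prop) ?_) (by fun_prop)
    rintro ⟨r, t⟩
    apply mem_closure_unitB
    have : (κ r) ^ 2 ≤ 1 := by nlinarith [hκ0 r, hκ1 r]
    simp only
    nlinarith [Real.sin_sq_add_cos_sq t]
  have heq : Set.EqOn (fun r : ℝ =>
      ∫ t in (0 : ℝ)..2 * π, w (κ r * Real.cos t, κ r * Real.sin t) * φ t) A (Set.Ioo 0 1) := by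
    intro r hr
    have : κ r = r := by simp [κ, hr.1.le, hr.2.le]
    simp only [this]
    exact h r hr.1 hr.2
  have h1 := heq.closure hG hA (x := 1) (by rw [closure_Ioo (by norm_num)]; simp)
  simpa [κ] using h1

/-- The zeroth and first Fourier coefficients of the boundary values of a harmonic function. -/
theorem harmonic_boundary_integrals {w : ℝ × ℝ → ℝ} (hw : ContDiffOn ℝ 2 w unitB)
    (hlap : ∀ p ∈ unitB, pd1 (pd1 w) p + pd2 (pd2 w) p = 0)
    (hc : ContinuousOn w (closure unitB)) :
    (∫ t in (0 : ℝ)..2 * π, w (Real.cos t, Real.sin t) = 2 * π * w (0, 0)) ∧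
    (∫ t in (0 : ℝ)..2 * π, w (Real.cos t, Real.sin t) * Real.cos t = π * pd1 w (0, 0)) ∧
    (∫ t in (0 : ℝ)..2 * π, w (Real.cos t, Real.sin t) * Real.sin t = π * pd2 w (0, 0)) := by
  obtain ⟨F, hF, hre⟩ := exists_holomorphic_re_eq hw hlap
  obtain ⟨h1, h2⟩ := pd_eq_re_deriv hF hre zero_mem_unitB
  have hz := hre _ zero_mem_unitB
  rw [equivRealProdCLM_symm_zero] at h1 h2 hz
  have hval : ∀ r : ℝ, 0 < r → r < 1 → ∀ t,
      (F (circleMap 0 r t)).re = w (r * Real.cos t, r * Real.sin t) := fun r hr0 hr1 t => by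
    rw [circleMap_eq_equivRealProdCLM_symm, hre _ (mul_cos_sin_mem_unitB hr0 hr1 t)]
  have hcoef : ∀ r : ℝ, 0 < r → r < 1 →
      ∫ t in (0 : ℝ)..2 * π, ((w (r * Real.cos t, r * Real.sin t) : ℝ) : ℂ) * cexp (-(t * I)) =
        π * r * deriv F 0 := fun r hr0 hr1 => by
    have := integral_re_mul_exp hF hr0 hr1 0
    simpa [hval r hr0 hr1] using this
  have hexp : ∀ t : ℝ, cexp (-(t * I)) = ⟨Real.cos t, -Real.sin t⟩ := fun t => by
    rw [← neg_mul, ← ofReal_neg, Complex.exp_mul_I]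
    apply Complex.ext <;> simp [← ofReal_cos, ← ofReal_sin, -ofReal_neg]
  have hii : ∀ r : ℝ, 0 < r → r < 1 → IntervalIntegrable (fun t : ℝ =>
      ((w (r * Real.cos t, r * Real.sin t) : ℝ) : ℂ) * cexp (-(t * I))) volume 0 (2 * π) :=
    fun r hr0 hr1 => by
      refine Continuous.intervalIntegrable (Continuous.mul ?_ (by fun_prop)) _ _
      refine continuous_ofReal.comp (hc.comp_continuous (by fun_prop) fun t => ?_)
      exact subset_closure (mul_cos_sin_mem_unitB hr0 hr1 t)
  refine ⟨?_, ?_, ?_⟩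
  · have := integral_circle_limit hc (φ := fun _ => 1) continuous_const
      (A := fun _ => 2 * π * w (0, 0)) continuous_const fun r hr0 hr1 => by
        have := integral_re_eq hF hr0 hr1
        simp only [hval r hr0 hr1] at this
        simp only [mul_one]
        rw [this, hz]
    simpa using this
  · have := integral_circle_limit hc (φ := Real.cos) Real.continuous_cos
      (A := fun r => π * r * pd1 w (0, 0)) (by fun_prop) fun r hr0 hr1 => by
        have h := reCLM.intervalIntegral_comp_comm (hii r hr0 hr1)
        rw [hcoef r hr0 hr1] at h
        simp only [reCLM_apply, hexp, re_ofReal_mul] at h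
        rw [h, h1, ← ofReal_mul, re_ofReal_mul]
    simpa using this
  · have := integral_circle_limit hc (φ := Real.sin) Real.continuous_sin
      (A := fun r => π * r * pd2 w (0, 0)) (by fun_prop) fun r hr0 hr1 => by
        have h := imCLM.intervalIntegral_comp_comm (hii r hr0 hr1)
        rw [hcoef r hr0 hr1] at h
        simp only [imCLM_apply, hexp, im_ofReal_mul, mul_neg, intervalIntegral.integral_neg] at h
        rw [← ofReal_mul, im_ofReal_mul] at h
        rw [h2]
        simp only [mul_re, I_re, I_im]
        linarith
    simpa using this

theorem forall_pos_or_forall_neg_of_ne_zero {g : ℝ → ℝ} (hg : Continuous g) {a b : ℝ}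
    (h : ∀ t ∈ Set.Ioo a b, g t ≠ 0) :
    (∀ t ∈ Set.Ioo a b, 0 < g t) ∨ ∀ t ∈ Set.Ioo a b, g t < 0 := by
  by_contra! hcon
  obtain ⟨⟨x, hx, hgx⟩, y, hy, hgy⟩ := hcon
  obtain ⟨z, hz, hgz⟩ := isPreconnected_Ioo.intermediate_value hx hy hg.continuousOn ⟨hgx, hgy⟩
  exact h z hz hgz

/-- A continuous periodic function with exactly two sign changes per period has the sign pattern
of a function `t ↦ cos (t - θ) - c`. -/
theorem exists_mul_cos_sub_nonneg {g : ℝ → ℝ} (hg : Continuous g)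
    (hper : Function.Periodic g (2 * π)) {s s' : ℝ} (h1 : s < s') (h2 : s' < s + 2 * π)
    (hs : g s = 0) (hs' : g s' = 0)
    (hz : ∀ t ∈ Set.Ico s (s + 2 * π), g t = 0 → t = s ∨ t = s')
    (hpos : ∃ t, 0 < g t) (hneg : ∃ t, g t < 0) :
    ∃ θ c : ℝ, |c| ≤ 1 ∧ ∀ t, 0 ≤ g t * (Real.cos (t - θ) - c) := by
  set θ := (s + s') / 2 with hθ
  set c := Real.cos ((s' - s) / 2) with hc
  have hl : ∀ t, Real.cos (t - θ) - c =
      -2 * Real.sin ((t - s) / 2) * Real.sin ((t - s') / 2) := by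
    intro t
    rw [hc, Real.cos_sub_cos]
    congr 3
    · congr 1
      rw [hθ]; ring
    · rw [hθ]; ring
  have hl1 : ∀ t ∈ Set.Ioo s s', 0 < Real.cos (t - θ) - c := by
    rintro t ⟨ht1, ht2⟩
    have ha : 0 < Real.sin ((t - s) / 2) :=
      Real.sin_pos_of_pos_of_lt_pi (by linarith) (by linarith)
    have hb : Real.sin ((t - s') / 2) < 0 :=
      Real.sin_neg_of_neg_of_neg_pi_lt (by linarith) (by linarith)
    rw [hl]
    nlinarith [mul_neg_of_pos_of_neg ha hb]
  have hl2 : ∀ t ∈ Set.Ioo s' (s + 2 * π), Real.cos (t - θ) - c < 0 := by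
    rintro t ⟨ht1, ht2⟩
    have ha : 0 < Real.sin ((t - s) / 2) :=
      Real.sin_pos_of_pos_of_lt_pi (by linarith) (by linarith)
    have hb : 0 < Real.sin ((t - s') / 2) :=
      Real.sin_pos_of_pos_of_lt_pi (by linarith) (by linarith)
    rw [hl]
    nlinarith [mul_pos ha hb]
  have hsplit : ∀ t ∈ Set.Ico s (s + 2 * π),
      g t = 0 ∨ t ∈ Set.Ioo s s' ∨ t ∈ Set.Ioo s' (s + 2 * π) := by
    rintro t ⟨ht1, ht2⟩
    rcases ht1.eq_or_lt with rfl | ht1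
    · exact Or.inl hs
    rcases lt_trichotomy t s' with h | rfl | h
    · exact Or.inr (Or.inl ⟨ht1, h⟩)
    · exact Or.inl hs'
    · exact Or.inr (Or.inr ⟨h, ht2⟩)
  have hn1 : ∀ t ∈ Set.Ioo s s', g t ≠ 0 := by
    rintro t ⟨ht1, ht2⟩ h0
    rcases hz t ⟨ht1.le, by linarith⟩ h0 with h | h <;> linarith
  have hn2 : ∀ t ∈ Set.Ioo s' (s + 2 * π), g t ≠ 0 := by
    rintro t ⟨ht1, ht2⟩ h0
    rcases hz t ⟨by linarith, ht2⟩ h0 with h | h <;> linarith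
  have hperl : ∀ θ c : ℝ, Function.Periodic (fun t => g t * (Real.cos (t - θ) - c)) (2 * π) := by
    intro θ c t
    simp only
    rw [hper t, show t + 2 * π - θ = t - θ + 2 * π by ring, Real.cos_add_two_pi]
  have hcabs : |c| ≤ 1 := Real.abs_cos_le_one _
  rcases forall_pos_or_forall_neg_of_ne_zero hg hn1 with p1 | p1 <;>
    rcases forall_pos_or_forall_neg_of_ne_zero hg hn2 with p2 | p2
  · obtain ⟨t, ht⟩ := hneg
    obtain ⟨y, hy, hty⟩ := hper.exists_mem_Ico Real.two_pi_pos t s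
    rcases hsplit y hy with h | h | h
    · linarith
    · linarith [p1 y h]
    · linarith [p2 y h]
  · refine ⟨θ, c, hcabs, fun t => ?_⟩
    obtain ⟨y, hy, hty⟩ := (hperl θ c).exists_mem_Ico Real.two_pi_pos t s
    rw [hty]
    rcases hsplit y hy with h | h | h
    · simp [h]
    · exact (mul_pos (p1 y h) (hl1 y h)).le
    · exact (mul_pos_of_neg_of_neg (p2 y h) (hl2 y h)).le
  · refine ⟨θ + π, -c, by rwa [abs_neg], fun t => ?_⟩
    have hflip : ∀ t, Real.cos (t - (θ + π)) - -c = -(Real.cos (t - θ) - c) := fun t => by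
      rw [← sub_sub, Real.cos_sub_pi]; ring
    obtain ⟨y, hy, hty⟩ := (hperl (θ + π) (-c)).exists_mem_Ico Real.two_pi_pos t s
    rw [hty, hflip]
    rcases hsplit y hy with h | h | h
    · simp [h]
    · exact (mul_pos_of_neg_of_neg (p1 y h) (neg_neg_of_pos (hl1 y h))).le
    · exact (mul_pos (p2 y h) (neg_pos.2 (hl2 y h))).le
  · obtain ⟨t, ht⟩ := hpos
    obtain ⟨y, hy, hty⟩ := hper.exists_mem_Ico Real.two_pi_pos t s
    rcases hsplit y hy with h | h | h
    · linarith
    · linarith [p1 y h]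
    · linarith [p2 y h]

theorem cos_sin_mem_circleR (t : ℝ) : (Real.cos t, Real.sin t) ∈ circleR 1 := by
  simp [circleR]

theorem exists_eq_cos_sin {z : ℝ × ℝ} (hz : z ∈ circleR 1) (s : ℝ) :
    ∃ t ∈ Set.Ico s (s + 2 * π), z = (Real.cos t, Real.sin t) := by
  have h : z.1 ^ 2 + z.2 ^ 2 = 1 := by simpa [circleR] using hz
  have hn : ‖(⟨z.1, z.2⟩ : ℂ)‖ = 1 := by
    rw [← sq_eq_sq₀ (norm_nonneg _) zero_le_one, Complex.sq_norm, normSq_apply]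
    simp only
    linarith
  have hper : Function.Periodic (fun t : ℝ => (Real.cos t, Real.sin t)) (2 * π) := fun t => by
    simp
  obtain ⟨y, hy, hty⟩ := hper.exists_mem_Ico Real.two_pi_pos (arg ⟨z.1, z.2⟩) s
  refine ⟨y, hy, ?_⟩
  rw [← hty]
  have hne : (⟨z.1, z.2⟩ : ℂ) ≠ 0 := by
    rw [← norm_ne_zero_iff, hn]; exact one_ne_zero
  simp [Complex.cos_arg hne, Complex.sin_arg, hn]

theorem eq_of_cos_sin_eq {s t : ℝ} (hst : |t - s| < 2 * π)
    (h : (Real.cos t, Real.sin t) = (Real.cos s, Real.sin s)) : t = s := by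
  obtain ⟨hc, hs⟩ := Prod.mk.inj h
  have h1 : Real.cos (t - s) = 1 := by
    rw [Real.cos_sub, hc, hs]
    linarith [Real.sin_sq_add_cos_sq s]
  rw [abs_lt] at hst
  have := (Real.cos_eq_one_iff_of_lt_of_lt hst.1 hst.2).1 h1
  linarith

/-- A continuous function on the unit circle with exactly two zeros and attaining both signs has
the sign pattern of an affine function. -/
theorem exists_circle_mul_cos_sub_nonneg {u : ℝ × ℝ → ℝ} (hu : ContinuousOn u (circleR 1))
    {p q : ℝ × ℝ} (hp : p ∈ circleR 1) (hq : q ∈ circleR 1) (hpq : p ≠ q)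
    (hup : u p = 0) (huq : u q = 0) (hz : ∀ z ∈ circleR 1, u z = 0 → z = p ∨ z = q)
    (hpos : ∃ z ∈ circleR 1, 0 < u z) (hneg : ∃ z ∈ circleR 1, u z < 0) :
    ∃ θ c : ℝ, |c| ≤ 1 ∧ ∀ t, 0 ≤ u (Real.cos t, Real.sin t) * (Real.cos (t - θ) - c) := by
  obtain ⟨s, -, rfl⟩ := exists_eq_cos_sin hp 0
  obtain ⟨s', ⟨hs1, hs2⟩, rfl⟩ := exists_eq_cos_sin hq s
  have hlt : s < s' := lt_of_le_of_ne hs1 fun h => hpq (by rw [h])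
  refine exists_mul_cos_sub_nonneg (g := fun t => u (Real.cos t, Real.sin t))
    (hu.comp_continuous (by fun_prop) cos_sin_mem_circleR) (fun t => by simp) hlt hs2 hup huq
    ?_ ?_ ?_
  · rintro t ⟨ht1, ht2⟩ h0
    refine (hz _ (cos_sin_mem_circleR t) h0).imp (fun h => ?_) (fun h => ?_)
    · exact eq_of_cos_sin_eq (by rw [abs_lt]; constructor <;> linarith) h
    · exact eq_of_cos_sin_eq (by rw [abs_lt]; constructor <;> linarith) h
  · obtain ⟨z, hz, h⟩ := hpos
    obtain ⟨t, -, rfl⟩ := exists_eq_cos_sin hz 0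
    exact ⟨t, h⟩
  · obtain ⟨z, hz, h⟩ := hneg
    obtain ⟨t, -, rfl⟩ := exists_eq_cos_sin hz 0
    exact ⟨t, h⟩

theorem integral_cos_int_mul_sub {m : ℤ} (hm : m ≠ 0) (d : ℝ) :
    ∫ t in (0 : ℝ)..2 * π, Real.cos (m * t - d) = 0 := by
  have hm' : (m : ℝ) ≠ 0 := by exact_mod_cast hm
  rw [intervalIntegral.integral_comp_mul_sub (fun x => Real.cos x) hm' d, integral_cos]
  have : (m : ℝ) * (2 * π) - d = (m * 0 - d) + m * (2 * π) := by ring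
  rw [this, Real.sin_add_int_mul_two_pi]
  simp

theorem integral_cos_sub_mul_cos_sub (θ₁ θ₂ c₁ c₂ : ℝ) :
    ∫ t in (0 : ℝ)..2 * π, (Real.cos (t - θ₁) - c₁) * (Real.cos (t - θ₂) - c₂) *
      Real.cos (2 * t - (θ₁ + θ₂)) = π / 2 := by
  have hexpand : ∀ t : ℝ, (Real.cos (t - θ₁) - c₁) * (Real.cos (t - θ₂) - c₂) *
      Real.cos (2 * t - (θ₁ + θ₂)) =
      1 / 4 + 1 / 4 * Real.cos ((4 : ℤ) * t - 2 * (θ₁ + θ₂))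
        + Real.cos (θ₁ - θ₂) / 2 * Real.cos ((2 : ℤ) * t - (θ₁ + θ₂))
        - c₂ / 2 * Real.cos ((3 : ℤ) * t - (2 * θ₁ + θ₂))
        - c₂ / 2 * Real.cos ((1 : ℤ) * t - θ₂)
        - c₁ / 2 * Real.cos ((3 : ℤ) * t - (θ₁ + 2 * θ₂))
        - c₁ / 2 * Real.cos ((1 : ℤ) * t - θ₁)
        + c₁ * c₂ * Real.cos ((2 : ℤ) * t - (θ₁ + θ₂)) := by
    intro t
    push_cast
    have e1 : 2 * t - (θ₁ + θ₂) = (t - θ₁) + (t - θ₂) := by ring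
    have e2 : 4 * t - 2 * (θ₁ + θ₂) = 2 * ((t - θ₁) + (t - θ₂)) := by ring
    have e3 : 3 * t - (2 * θ₁ + θ₂) = ((t - θ₁) + (t - θ₂)) + (t - θ₁) := by ring
    have e4 : 3 * t - (θ₁ + 2 * θ₂) = ((t - θ₁) + (t - θ₂)) + (t - θ₂) := by ring
    have e5 : (1 : ℝ) * t - θ₂ = ((t - θ₁) + (t - θ₂)) - (t - θ₁) := by ring
    have e6 : (1 : ℝ) * t - θ₁ = ((t - θ₁) + (t - θ₂)) - (t - θ₂) := by ring
    have e7 : θ₁ - θ₂ = (t - θ₂) - (t - θ₁) := by ring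
    have hA : Real.cos (θ₁ - θ₂) + Real.cos ((t - θ₁) + (t - θ₂)) =
        2 * Real.cos (t - θ₁) * Real.cos (t - θ₂) := by
      rw [e7, Real.cos_sub (t - θ₂), Real.cos_add]; ring
    rw [e1, e2, e3, e4, e5, e6, Real.cos_two_mul, Real.cos_add (t - θ₁ + (t - θ₂)) (t - θ₁),
      Real.cos_sub (t - θ₁ + (t - θ₂)) (t - θ₁), Real.cos_add (t - θ₁ + (t - θ₂)) (t - θ₂),
      Real.cos_sub (t - θ₁ + (t - θ₂)) (t - θ₂)]
    linear_combination (-1 / 2 * Real.cos ((t - θ₁) + (t - θ₂))) * hA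
  simp_rw [hexpand]
  have hi : ∀ f : ℝ → ℝ, Continuous f → IntervalIntegrable f volume 0 (2 * π) :=
    fun f hf => hf.intervalIntegrable _ _
  rw [intervalIntegral.integral_add (hi _ (by fun_prop)) (hi _ (by fun_prop)),
    intervalIntegral.integral_sub (hi _ (by fun_prop)) (hi _ (by fun_prop)),
    intervalIntegral.integral_sub (hi _ (by fun_prop)) (hi _ (by fun_prop)),
    intervalIntegral.integral_sub (hi _ (by fun_prop)) (hi _ (by fun_prop)),
    intervalIntegral.integral_sub (hi _ (by fun_prop)) (hi _ (by fun_prop)),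
    intervalIntegral.integral_add (hi _ (by fun_prop)) (hi _ (by fun_prop)),
    intervalIntegral.integral_add (hi _ (by fun_prop)) (hi _ (by fun_prop))]
  simp only [intervalIntegral.integral_const_mul]
  rw [integral_cos_int_mul_sub (by norm_num), integral_cos_int_mul_sub (by norm_num),
    integral_cos_int_mul_sub (by norm_num), integral_cos_int_mul_sub (by norm_num),
    integral_cos_int_mul_sub (by norm_num), integral_cos_int_mul_sub (by norm_num)]
  simp
  ring

theorem integral_mul_cos_sub {g : ℝ → ℝ} (hg : Continuous g) {a b : ℝ} (θ c : ℝ)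
    (h0 : ∫ t in (0 : ℝ)..2 * π, g t = 0)
    (hc : ∫ t in (0 : ℝ)..2 * π, g t * Real.cos t = π * a)
    (hs : ∫ t in (0 : ℝ)..2 * π, g t * Real.sin t = π * b) :
    ∫ t in (0 : ℝ)..2 * π, g t * (Real.cos (t - θ) - c) =
      π * (a * Real.cos θ + b * Real.sin θ) := by
  have hexpand : ∀ t, g t * (Real.cos (t - θ) - c) =
      Real.cos θ * (g t * Real.cos t) + Real.sin θ * (g t * Real.sin t) - c * g t := fun t => by
    rw [Real.cos_sub]; ring
  simp_rw [hexpand]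
  rw [intervalIntegral.integral_sub (Continuous.intervalIntegrable (by fun_prop) _ _)
      (Continuous.intervalIntegrable (by fun_prop) _ _),
    intervalIntegral.integral_add (Continuous.intervalIntegrable (by fun_prop) _ _)
      (Continuous.intervalIntegrable (by fun_prop) _ _)]
  simp only [intervalIntegral.integral_const_mul]
  rw [h0, hc, hs]
  ring

/-- A lower bound in the spirit of Heinz for the first Fourier coefficients of a pair of functions
whose sign patterns are those of affine functions on the circle. -/
theorem heinz_fourier_bound {g₁ g₂ : ℝ → ℝ} (hg₁ : Continuous g₁) (hg₂ : Continuous g₂)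
    {R a₁ b₁ a₂ b₂ θ₁ θ₂ c₁ c₂ : ℝ} (hR : 0 ≤ R) (hsum : ∀ t, R ≤ |g₁ t| + |g₂ t|)
    (hc₁ : |c₁| ≤ 1) (hc₂ : |c₂| ≤ 1)
    (hn₁ : ∀ t, 0 ≤ g₁ t * (Real.cos (t - θ₁) - c₁))
    (hn₂ : ∀ t, 0 ≤ g₂ t * (Real.cos (t - θ₂) - c₂))
    (h0₁ : ∫ t in (0 : ℝ)..2 * π, g₁ t = 0) (h0₂ : ∫ t in (0 : ℝ)..2 * π, g₂ t = 0)
    (hcos₁ : ∫ t in (0 : ℝ)..2 * π, g₁ t * Real.cos t = π * a₁)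
    (hsin₁ : ∫ t in (0 : ℝ)..2 * π, g₁ t * Real.sin t = π * b₁)
    (hcos₂ : ∫ t in (0 : ℝ)..2 * π, g₂ t * Real.cos t = π * a₂)
    (hsin₂ : ∫ t in (0 : ℝ)..2 * π, g₂ t * Real.sin t = π * b₂) :
    R / 4 ≤ (a₁ * Real.cos θ₁ + b₁ * Real.sin θ₁) + (a₂ * Real.cos θ₂ + b₂ * Real.sin θ₂) := by
  have hpt : ∀ t : ℝ, R / 2 * ((Real.cos (t - θ₁) - c₁) * (Real.cos (t - θ₂) - c₂) *
      Real.cos (2 * t - (θ₁ + θ₂))) ≤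
      g₁ t * (Real.cos (t - θ₁) - c₁) + g₂ t * (Real.cos (t - θ₂) - c₂) := by
    intro t
    rw [← abs_of_nonneg (hn₁ t), ← abs_of_nonneg (hn₂ t), abs_mul, abs_mul]
    have hb : ∀ θ c : ℝ, |c| ≤ 1 → |Real.cos (t - θ) - c| ≤ 2 := fun θ c hc =>
      (abs_sub _ _).trans (by linarith [Real.abs_cos_le_one (t - θ)])
    have hx := hb θ₁ c₁ hc₁
    have hy := hb θ₂ c₂ hc₂
    have hx0 := abs_nonneg (Real.cos (t - θ₁) - c₁)
    have hy0 := abs_nonneg (Real.cos (t - θ₂) - c₂)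
    have hprod : (Real.cos (t - θ₁) - c₁) * (Real.cos (t - θ₂) - c₂) *
        Real.cos (2 * t - (θ₁ + θ₂)) ≤
        |Real.cos (t - θ₁) - c₁| * |Real.cos (t - θ₂) - c₂| := by
      refine (le_abs_self _).trans ?_
      rw [abs_mul, abs_mul]
      exact mul_le_of_le_one_right (by positivity) (Real.abs_cos_le_one _)
    generalize |Real.cos (t - θ₁) - c₁| = x at *
    generalize |Real.cos (t - θ₂) - c₂| = y at *
    have hxy1 : x * y / 2 ≤ x := by nlinarith
    have hxy2 : x * y / 2 ≤ y := by nlinarith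
    have hxy0 : 0 ≤ x * y / 2 := by positivity
    calc R / 2 * _ ≤ R / 2 * (x * y) := by gcongr
      _ = R * (x * y / 2) := by ring
      _ ≤ (|g₁ t| + |g₂ t|) * (x * y / 2) := by gcongr; exact hsum t
      _ = |g₁ t| * (x * y / 2) + |g₂ t| * (x * y / 2) := by ring
      _ ≤ |g₁ t| * x + |g₂ t| * y := by gcongr
  have hint := intervalIntegral.integral_mono (μ := volume) Real.two_pi_pos.le
    (Continuous.intervalIntegrable (by fun_prop) _ _)
    (Continuous.intervalIntegrable (by fun_prop) _ _) hpt
  rw [intervalIntegral.integral_const_mul, integral_cos_sub_mul_cos_sub,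
    intervalIntegral.integral_add (Continuous.intervalIntegrable (by fun_prop) _ _)
      (Continuous.intervalIntegrable (by fun_prop) _ _),
    integral_mul_cos_sub hg₁ θ₁ c₁ h0₁ hcos₁ hsin₁,
    integral_mul_cos_sub hg₂ θ₂ c₂ h0₂ hcos₂ hsin₂, ← mul_add] at hint
  have hpi := Real.pi_pos
  by_contra! hlt
  nlinarith

/-- The Heinz gradient bound for harmonic maps of the disc that are bijective on the boundary. -/
theorem harmonic_disc_gradient_bound {x y : ℝ × ℝ → ℝ} {R : ℝ} (hR : 0 < R)
    (hx : ContDiffOn ℝ 2 x unitB) (hy : ContDiffOn ℝ 2 y unitB)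
    (hxl : ∀ p ∈ unitB, pd1 (pd1 x) p + pd2 (pd2 x) p = 0)
    (hyl : ∀ p ∈ unitB, pd1 (pd1 y) p + pd2 (pd2 y) p = 0)
    (hxc : ContinuousOn x (closure unitB)) (hyc : ContinuousOn y (closure unitB))
    (hbij : Set.BijOn (fun p => (x p, y p)) (circleR 1) (circleR R))
    (hx0 : x (0, 0) = 0) (hy0 : y (0, 0) = 0) :
    R ^ 2 / 32 ≤ pd1 x (0, 0) ^ 2 + pd2 x (0, 0) ^ 2 + pd1 y (0, 0) ^ 2 + pd2 y (0, 0) ^ 2 := by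
  obtain ⟨hmaps, hinj, hsurj⟩ := hbij
  have hsub : circleR 1 ⊆ closure unitB := fun z hz =>
    mem_closure_unitB (by simpa [circleR] using (show z.1 ^ 2 + z.2 ^ 2 = 1 ^ 2 from hz).le)
  have hcirc : ∀ z ∈ circleR 1, x z ^ 2 + y z ^ 2 = R ^ 2 := fun z hz => hmaps hz
  have hpre : ∀ a b : ℝ, a ^ 2 + b ^ 2 = R ^ 2 → ∃ z ∈ circleR 1, x z = a ∧ y z = b := by
    intro a b hab
    obtain ⟨z, hz, h⟩ := hsurj (show (a, b) ∈ circleR R from hab)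
    exact ⟨z, hz, Prod.mk.inj h⟩
  obtain ⟨zN, hzN, hxN, hyN⟩ := hpre 0 R (by ring)
  obtain ⟨zS, hzS, hxS, hyS⟩ := hpre 0 (-R) (by ring)
  obtain ⟨zE, hzE, hxE, hyE⟩ := hpre R 0 (by ring)
  obtain ⟨zW, hzW, hxW, hyW⟩ := hpre (-R) 0 (by ring)
  have heq : ∀ z ∈ circleR 1, ∀ z' ∈ circleR 1, x z = x z' → y z = y z' → z = z' :=
    fun z hz z' hz' h1 h2 => hinj hz hz' (Prod.ext h1 h2)
  obtain ⟨θ₁, c₁, hc₁, hn₁⟩ := exists_circle_mul_cos_sub_nonneg (hxc.mono hsub) hzN hzS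
    (fun h => by rw [h] at hyN; linarith) hxN hxS (fun z hz h => by
      have h2 := hcirc z hz
      rw [h] at h2
      rcases sq_eq_sq_iff_eq_or_eq_neg.1 (show y z ^ 2 = R ^ 2 by linarith) with h3 | h3
      · exact Or.inl (heq z hz zN hzN (by rw [h, hxN]) (by rw [h3, hyN]))
      · exact Or.inr (heq z hz zS hzS (by rw [h, hxS]) (by rw [h3, hyS])))
    ⟨zE, hzE, by rw [hxE]; exact hR⟩ ⟨zW, hzW, by rw [hxW]; linarith⟩
  obtain ⟨θ₂, c₂, hc₂, hn₂⟩ := exists_circle_mul_cos_sub_nonneg (hyc.mono hsub) hzE hzW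
    (fun h => by rw [h] at hxE; linarith) hyE hyW (fun z hz h => by
      have h2 := hcirc z hz
      rw [h] at h2
      rcases sq_eq_sq_iff_eq_or_eq_neg.1 (show x z ^ 2 = R ^ 2 by linarith) with h3 | h3
      · exact Or.inl (heq z hz zE hzE (by rw [h3, hxE]) (by rw [h, hyE]))
      · exact Or.inr (heq z hz zW hzW (by rw [h3, hxW]) (by rw [h, hyW])))
    ⟨zN, hzN, by rw [hyN]; exact hR⟩ ⟨zS, hzS, by rw [hyS]; linarith⟩
  obtain ⟨h0₁, hcos₁, hsin₁⟩ := harmonic_boundary_integrals hx hxl hxc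
  obtain ⟨h0₂, hcos₂, hsin₂⟩ := harmonic_boundary_integrals hy hyl hyc
  rw [hx0, mul_zero] at h0₁
  rw [hy0, mul_zero] at h0₂
  have hsum : ∀ t, R ≤ |x (Real.cos t, Real.sin t)| + |y (Real.cos t, Real.sin t)| := by
    intro t
    have h := hcirc _ (cos_sin_mem_circleR t)
    rw [← sq_abs (x _), ← sq_abs (y _)] at h
    refine (sq_le_sq₀ hR.le (by positivity)).1 ?_
    nlinarith [mul_nonneg (abs_nonneg (x (Real.cos t, Real.sin t)))
      (abs_nonneg (y (Real.cos t, Real.sin t)))]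
  have hcont : ∀ {w : ℝ × ℝ → ℝ}, ContinuousOn w (closure unitB) →
      Continuous fun t => w (Real.cos t, Real.sin t) := fun hw =>
    hw.comp_continuous (by fun_prop) fun t => hsub (cos_sin_mem_circleR t)
  have hbound := heinz_fourier_bound (hcont hxc) (hcont hyc) hR.le hsum hc₁ hc₂ hn₁ hn₂ h0₁ h0₂
    hcos₁ hsin₁ hcos₂ hsin₂
  have hcs : ∀ a b θ : ℝ, (a * Real.cos θ + b * Real.sin θ) ^ 2 ≤ a ^ 2 + b ^ 2 := by
    intro a b θ
    have : a ^ 2 + b ^ 2 - (a * Real.cos θ + b * Real.sin θ) ^ 2 =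
        (a * Real.sin θ - b * Real.cos θ) ^ 2 := by
      linear_combination (-(a ^ 2 + b ^ 2)) * Real.sin_sq_add_cos_sq θ
    linarith [sq_nonneg (a * Real.sin θ - b * Real.cos θ)]
  have hA := hcs (pd1 x (0, 0)) (pd2 x (0, 0)) θ₁
  have hB := hcs (pd1 y (0, 0)) (pd2 y (0, 0)) θ₂
  generalize pd1 x (0, 0) * Real.cos θ₁ + pd2 x (0, 0) * Real.sin θ₁ = A at *
  generalize pd1 y (0, 0) * Real.cos θ₂ + pd2 y (0, 0) * Real.sin θ₂ = B at *
  have hsq : (R / 4) ^ 2 ≤ (A + B) ^ 2 := pow_le_pow_left₀ (by positivity) hbound 2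
  nlinarith [sq_nonneg (A - B)]

section ContinuousLinearMapComp

variable {E : Type*} [NormedAddCommGroup E] [NormedSpace ℝ E] (L : E →L[ℝ] ℝ)
  {X : ℝ × ℝ → E} {p : ℝ × ℝ}

theorem pd1_clm_comp (hX : DifferentiableAt ℝ X p) : pd1 (L ∘ X) p = L (pd1 X p) := by
  rw [pd1, (L.hasFDerivAt.comp p hX.hasFDerivAt).fderiv]
  rfl

theorem pd2_clm_comp (hX : DifferentiableAt ℝ X p) : pd2 (L ∘ X) p = L (pd2 X p) := by
  rw [pd2, (L.hasFDerivAt.comp p hX.hasFDerivAt).fderiv]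
  rfl

theorem snd_pd_clm_comp (hX : ContDiffOn ℝ 2 X unitB) (hp : p ∈ unitB) :
    pd1 (pd1 (L ∘ X)) p = L (pd1 (pd1 X) p) ∧ pd1 (pd2 (L ∘ X)) p = L (pd1 (pd2 X) p) ∧
      pd2 (pd2 (L ∘ X)) p = L (pd2 (pd2 X) p) := by
  have hXd : ∀ q ∈ unitB, DifferentiableAt ℝ X q := fun q hq =>
    (hX.contDiffAt (isOpen_unitB.mem_nhds hq)).differentiableAt (by norm_num)
  have hdd : DifferentiableAt ℝ (fderiv ℝ X) p :=
    ((hX.contDiffAt (isOpen_unitB.mem_nhds hp)).fderiv_right (m := 1)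
      (by norm_num)).differentiableAt (by norm_num)
  have hd1 : DifferentiableAt ℝ (pd1 X) p := hdd.clm_apply (by fun_prop)
  have hd2 : DifferentiableAt ℝ (pd2 X) p := hdd.clm_apply (by fun_prop)
  have he1 : pd1 (L ∘ X) =ᶠ[𝓝 p] L ∘ pd1 X := by
    filter_upwards [isOpen_unitB.mem_nhds hp] with q hq using pd1_clm_comp L (hXd q hq)
  have he2 : pd2 (L ∘ X) =ᶠ[𝓝 p] L ∘ pd2 X := by
    filter_upwards [isOpen_unitB.mem_nhds hp] with q hq using pd2_clm_comp L (hXd q hq)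
  refine ⟨?_, ?_, ?_⟩
  · rw [← pd1_clm_comp L hd1, pd1, he1.fderiv_eq, pd1]
  · rw [← pd1_clm_comp L hd2, pd1, he2.fderiv_eq, pd1]
  · rw [← pd2_clm_comp L hd2, pd2, he2.fderiv_eq, pd2]

theorem laplacian_clm_comp (hX : ContDiffOn ℝ 2 X unitB)
    (hlap : ∀ p ∈ unitB, pd1 (pd1 X) p + pd2 (pd2 X) p = 0) :
    ∀ p ∈ unitB, pd1 (pd1 (L ∘ X)) p + pd2 (pd2 (L ∘ X)) p = 0 := by
  intro p hp
  obtain ⟨h1, -, h2⟩ := snd_pd_clm_comp L hX hp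
  rw [h1, h2, ← map_add, hlap p hp, map_zero]

end ContinuousLinearMapComp

theorem sq_add_sq_le_norm_sq {n : ℕ} (v : EuclideanSpace ℝ (Fin n)) {i j : Fin n} (hij : i ≠ j) :
    v i ^ 2 + v j ^ 2 ≤ ‖v‖ ^ 2 := by
  rw [EuclideanSpace.real_norm_sq_eq, ← Finset.sum_pair (f := fun k => v k ^ 2) hij]
  exact Finset.sum_le_univ_sum_of_nonneg fun k => sq_nonneg _

/-- Gaussian curvature estimate for two-dimensional minimal surface graphs in ℝⁿ:
there is a universal constant `Θ'` such that, for any conformally parametrized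
minimal surface graph over `B_R`, the Gaussian curvature in the direction of
any differentiable unit normal field satisfies
`|K_N(0,0)| ≤ Θ'‖X‖²_{C⁰(B)}/R⁴`, where in conformal parameters
`K_N = (L₁₁L₂₂ − L₁₂²)/W²`. -/
theorem gauss_curvature_estimate_minimal_graph :
    ∃ Θ' : ℝ, 0 < Θ' ∧
      ∀ (n : ℕ), 3 ≤ n →
      ∀ (R : ℝ), 0 < R →
      ∀ (X : ℝ × ℝ → EuclideanSpace ℝ (Fin n)) (W : ℝ × ℝ → ℝ),
        ContDiffOn ℝ 2 X unitB →
        ContinuousOn X (closure unitB) →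
        -- `X` is harmonic (a conformally parametrized minimal surface)
        (∀ p ∈ unitB, pd1 (pd1 X) p + pd2 (pd2 X) p = 0) →
        -- conformality relations
        (∀ p ∈ unitB,
          ‖pd1 X p‖ ^ 2 = W p ∧ ‖pd2 X p‖ ^ 2 = W p ∧
          ⟪pd1 X p, pd2 X p⟫ = 0 ∧ 0 < W p) →
        -- the plane mapping `F* = (x¹, x²)` maps `B̄` one-to-one onto `B̄_R` ...
        ∀ hn' : 3 ≤ n,
        (Set.BijOn (fun p => (X p ⟨0, by omega⟩, X p ⟨1, by omega⟩))
          (closure unitB) (closure (diskR R))) →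
        -- ... with positive Jacobian in `B` ...
        (∀ p ∈ unitB,
          pd1 (fun q => X q (⟨0, by omega⟩ : Fin n)) p *
            pd2 (fun q => X q (⟨1, by omega⟩ : Fin n)) p -
          pd1 (fun q => X q (⟨1, by omega⟩ : Fin n)) p *
            pd2 (fun q => X q (⟨0, by omega⟩ : Fin n)) p > 0) →
        -- ... it satisfies `F*(0,0) = (0,0)` ...
        (X (0, 0) (⟨0, by omega⟩ : Fin n) = 0 ∧
         X (0, 0) (⟨1, by omega⟩ : Fin n) = 0) →
        -- ... and maps `∂B` topologically onto `∂B_R`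
        (Set.BijOn (fun p => (X p ⟨0, by omega⟩, X p ⟨1, by omega⟩))
          (circleR 1) (circleR R)) →
        -- then for every differentiable unit normal field `N` along `X` ...
        ∀ N : ℝ × ℝ → EuclideanSpace ℝ (Fin n),
          DifferentiableOn ℝ N unitB →
          (∀ p ∈ unitB, ‖N p‖ = 1 ∧ ⟪N p, pd1 X p⟫ = 0 ∧ ⟪N p, pd2 X p⟫ = 0) →
          -- ... the Gaussian curvature estimate holds at the origin:
          |(⟪pd1 (pd1 X) (0, 0), N (0, 0)⟫ * ⟪pd2 (pd2 X) (0, 0), N (0, 0)⟫ -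
            ⟪pd1 (pd2 X) (0, 0), N (0, 0)⟫ ^ 2) / (W (0, 0)) ^ 2|
            ≤ Θ' * (⨆ p : unitB, ‖X (p : ℝ × ℝ)‖) ^ 2 / R ^ 4 := by
  refine ⟨256 * 4096, by norm_num, ?_⟩
  intro n hn R hR X W hX hXc hlap hconf hn' _ _ h0 hcirc N _ hN
  obtain ⟨hW1, hW2, -, -⟩ := hconf _ zero_mem_unitB
  have hd := hX.contDiffAt (isOpen_unitB.mem_nhds zero_mem_unitB)
  have hWlow : R ^ 2 / 64 ≤ W (0, 0) := by
    let L : Fin n → EuclideanSpace ℝ (Fin n) →L[ℝ] ℝ := fun i => EuclideanSpace.proj i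
    have hgrad := harmonic_disc_gradient_bound hR
      (hX.continuousLinearMap_comp (L ⟨0, by omega⟩))
      (hX.continuousLinearMap_comp (L ⟨1, by omega⟩))
      (laplacian_clm_comp (L ⟨0, by omega⟩) hX hlap)
      (laplacian_clm_comp (L ⟨1, by omega⟩) hX hlap)
      ((L ⟨0, by omega⟩).continuous.comp_continuousOn hXc)
      ((L ⟨1, by omega⟩).continuous.comp_continuousOn hXc) hcirc h0.1 h0.2
    have hXd := hd.differentiableAt (by norm_num)
    rw [pd1_clm_comp _ hXd, pd1_clm_comp _ hXd, pd2_clm_comp _ hXd, pd2_clm_comp _ hXd] at hgrad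
    have hne : (⟨0, by omega⟩ : Fin n) ≠ ⟨1, by omega⟩ := by simp
    have h1 := sq_add_sq_le_norm_sq (pd1 X (0, 0)) hne
    have h2 := sq_add_sq_le_norm_sq (pd2 X (0, 0)) hne
    have hL : ∀ i v, L i v = v i := fun _ _ => rfl
    simp only [hL] at hgrad
    linarith
  set M := ⨆ p : unitB, ‖X (p : ℝ × ℝ)‖ with hM
  have hbdd : BddAbove (Set.range fun p : unitB => ‖X (p : ℝ × ℝ)‖) := by
    obtain ⟨C, hC⟩ := isCompact_closure_unitB.exists_bound_of_continuousOn hXc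
    refine ⟨C, ?_⟩
    rintro _ ⟨p, rfl⟩
    exact hC p (subset_closure p.2)
  set ν := N (0, 0) with hν
  have hν1 : ‖ν‖ = 1 := (hN _ zero_mem_unitB).1
  have hbound := harmonic_snd_deriv_bound (M := M)
    (hX.continuousLinearMap_comp (innerSL ℝ ν)) (laplacian_clm_comp (innerSL ℝ ν) hX hlap)
    fun p hp => by
      refine (abs_real_inner_le_norm ν (X p)).trans ?_
      rw [hν1, one_mul]
      exact le_ciSup hbdd ⟨p, hp⟩
  rw [(snd_pd_clm_comp _ hX zero_mem_unitB).1, (snd_pd_clm_comp _ hX zero_mem_unitB).2.1] at hbound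
  simp only [innerSL_apply_apply, real_inner_comm _ ν] at hbound
  have h22 : ⟪pd2 (pd2 X) (0, 0), ν⟫ = -⟪pd1 (pd1 X) (0, 0), ν⟫ := by
    rw [← inner_neg_left, eq_neg_of_add_eq_zero_right (hlap _ zero_mem_unitB)]
  have hW2low : R ^ 4 / 4096 ≤ W (0, 0) ^ 2 := by
    have := pow_le_pow_left₀ (by positivity) hWlow 2
    linarith [show (R ^ 2 / 64) ^ 2 = R ^ 4 / 4096 by ring]
  have hR4 : 0 < R ^ 4 := by positivity
  have hWpos : 0 < W (0, 0) ^ 2 := by linarith [show 0 < R ^ 4 / 4096 by positivity]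
  rw [h22, abs_div, abs_of_pos hWpos, div_le_div_iff₀ hWpos hR4]
  generalize ⟪pd1 (pd1 X) (0, 0), ν⟫ = x at *
  generalize ⟪pd1 (pd2 X) (0, 0), ν⟫ = y at *
  have habs : |x * -x - y ^ 2| = x ^ 2 + y ^ 2 := by
    rw [show x * -x - y ^ 2 = -(x ^ 2 + y ^ 2) by ring, abs_neg, abs_of_nonneg (by positivity)]
  rw [habs]
  calc (x ^ 2 + y ^ 2) * R ^ 4 ≤ (16 * M) ^ 2 * (4096 * W (0, 0) ^ 2) := by
        gcongr
        linarith
    _ = 256 * 4096 * M ^ 2 * W (0, 0) ^ 2 := by ring
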